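/- arXiv:2112.10973 — 8 statements merged into one kernel-verified Lean document; each statement's English description precedes it below -/
import Mathlib

section
/- Let G = (V,E) be a finite nonempty simple graph on n vertices and let mac(G) be the minimum average congestion over all dominating sets of G. Then there exists an edge set S ⊆ E with |S| ≤ (mac(G) − 1)·n such that the graph G' = (V, E ∖ S) admits a perfect code. -/
/-- The closed neighborhood `N[v] = {v} ∪ N(v)`. -/
def closedNbr {V : Type*} (G : SimpleGraph V) (v : V) : Set V :=
  insert v (G.neighborSet v)

/-- `D` is a dominating set of `G`. -/
def Dominating {V : Type*} (G : SimpleGraph V) (D : Set V) : Prop :=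
  ∀ v : V, ∃ u ∈ D, v ∈ closedNbr G u

/-- `D` is a perfect code of `G`: a dominating set meeting every closed neighborhood
exactly once. -/
def PerfectCode {V : Type*} (G : SimpleGraph V) (D : Set V) : Prop :=
  Dominating G D ∧ ∀ v : V, (closedNbr G v ∩ D).ncard = 1

/-- The average congestion of `S` in `G`: `(1/n) ∑_v |N[v] ∩ S|`. -/
noncomputable def avgcong {V : Type*} [Fintype V] (G : SimpleGraph V) (S : Set V) : ℝ :=
  (∑ v : V, ((closedNbr G v ∩ S).ncard : ℝ)) / (Fintype.card V : ℝ)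

/-- `mac(G)`: the minimum average congestion over all dominating sets of `G`. -/
noncomputable def mac {V : Type*} [Fintype V] (G : SimpleGraph V) : ℝ :=
  sInf {x : ℝ | ∃ D : Set V, Dominating G D ∧ avgcong G D = x}

theorem mac_attained {V : Type*} [Fintype V] (G : SimpleGraph V) :
    ∃ D : Set V, Dominating G D ∧ avgcong G D = mac G := by
  have hfin : {x : ℝ | ∃ D : Set V, Dominating G D ∧ avgcong G D = x}.Finite := by
    refine (Set.finite_range (fun D : Set V => avgcong G D)).subset ?_
    rintro x ⟨D, _, rfl⟩
    exact ⟨D, rfl⟩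
  have hne : {x : ℝ | ∃ D : Set V, Dominating G D ∧ avgcong G D = x}.Nonempty :=
    ⟨_, Set.univ, fun v => ⟨v, trivial, Set.mem_insert _ _⟩, rfl⟩
  exact hne.csInf_mem hfin

theorem mem_closedNbr' {V : Type*} (G : SimpleGraph V) (v w : V) :
    w ∈ closedNbr G v ↔ w = v ∨ G.Adj v w := by
  simp [closedNbr]

/-- One can delete at most `(mac(G) - 1)·n` edges from `G` so that the resulting
graph admits a perfect code. -/
theorem stmt_5 {V : Type*} [Fintype V] [Nonempty V] (G : SimpleGraph V) :
    ∃ S : Set (Sym2 V), S ⊆ G.edgeSet ∧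
      (S.ncard : ℝ) ≤ (mac G - 1) * (Fintype.card V : ℝ) ∧
      ∃ D : Set V, PerfectCode (G.deleteEdges S) D := by
  classical
  obtain ⟨D, hD, hmac⟩ := mac_attained G
  have hf : ∀ v, ∃ u, u ∈ D ∧ (u = v ∨ G.Adj v u) ∧ (v ∈ D → u = v) := by
    intro v
    by_cases hv : v ∈ D
    · exact ⟨v, hv, Or.inl rfl, fun _ => rfl⟩
    · obtain ⟨u, hu, h⟩ := hD v
      rw [mem_closedNbr'] at h
      exact ⟨u, hu, h.imp Eq.symm (fun h => h.symm), fun h => absurd h hv⟩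
  choose f hfD hfN hfv using hf
  let A : V → Finset V := fun v => (closedNbr G v ∩ D).toFinset.erase (f v)
  have hA : ∀ v u, u ∈ A v ↔ u ≠ f v ∧ (u = v ∨ G.Adj v u) ∧ u ∈ D := by
    intro v u
    simp [A, mem_closedNbr']
  let P : Finset (Σ _ : V, V) := Finset.univ.sigma A
  let S : Finset (Sym2 V) := P.image (fun p => s(p.1, p.2))
  have hadj : ∀ v u, u ∈ A v → G.Adj v u := by
    intro v u h
    obtain ⟨h1, h2 | h2, h3⟩ := (hA v u).1 h
    · subst h2
      exact absurd (hfv u h3).symm h1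
    · exact h2
  have hS : ∀ v u, s(v, u) ∈ S ↔ u ∈ A v ∨ v ∈ A u := by
    intro v u
    simp only [S, P, Finset.mem_image, Finset.mem_sigma, Finset.mem_univ, true_and, Sigma.exists,
      Sym2.eq_iff]
    constructor
    · rintro ⟨a, b, h, ⟨rfl, rfl⟩ | ⟨rfl, rfl⟩⟩
      · exact Or.inl h
      · exact Or.inr h
    · rintro (h | h)
      · exact ⟨v, u, h, Or.inl ⟨rfl, rfl⟩⟩
      · exact ⟨u, v, h, Or.inr ⟨rfl, rfl⟩⟩
  have key : ∀ v, closedNbr (G.deleteEdges (S : Set (Sym2 V))) v ∩ D = {f v} := by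
    intro v
    ext w
    simp only [Set.mem_inter_iff, mem_closedNbr', SimpleGraph.deleteEdges_adj, Finset.mem_coe, hS,
      Set.mem_singleton_iff]
    constructor
    · rintro ⟨rfl | ⟨h1, h2⟩, hw⟩
      · exact (hfv w hw).symm
      · by_contra hne
        exact h2 (Or.inl ((hA v w).2 ⟨hne, Or.inr h1, hw⟩))
    · rintro rfl
      refine ⟨?_, hfD v⟩
      rcases hfN v with h | h
      · exact Or.inl h
      · refine Or.inr ⟨h, ?_⟩
        rintro (h' | h')
        · exact ((hA _ _).1 h').1 rfl
        · have := hfv v ((hA _ _).1 h').2.2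
          rw [this] at h
          exact G.irrefl h
  refine ⟨S, ?_, ?_, D, ?_, ?_⟩
  · intro e
    induction e using Sym2.ind with
    | _ v u =>
      intro h
      rcases (hS v u).1 h with h | h
      · exact hadj _ _ h
      · exact (hadj _ _ h).symm
  · have hn : (Fintype.card V : ℝ) ≠ 0 := by
      exact_mod_cast Fintype.card_ne_zero
    rw [← hmac, avgcong, sub_mul, div_mul_cancel₀ _ hn, Set.ncard_coe_finset]
    have h1 : S.card ≤ ∑ v, (A v).card := by
      refine Finset.card_image_le.trans ?_
      simp [P]
    have h2 : ∀ v, ((A v).card : ℝ) = ((closedNbr G v ∩ D).ncard : ℝ) - 1 := by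
      intro v
      have hm : f v ∈ (closedNbr G v ∩ D).toFinset := by
        simp [mem_closedNbr', hfD, hfN]
      have := Finset.card_erase_add_one hm
      rw [Set.ncard_eq_toFinset_card', ← this]
      simp [A]
    calc (S.card : ℝ) ≤ ∑ v, ((A v).card : ℝ) := by exact_mod_cast h1
      _ = _ := by simp [h2, Finset.sum_sub_distrib]
      _ ≤ _ := le_rfl
  · intro v
    have : f v ∈ closedNbr (G.deleteEdges (S : Set (Sym2 V))) v ∩ D := by
      rw [key]; rfl
    refine ⟨f v, hfD v, ?_⟩
    have h := this.1
    rw [mem_closedNbr'] at h ⊢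
    exact h.imp Eq.symm (fun h => h.symm)
  · intro v
    rw [key, Set.ncard_singleton]
end

section
/- Let G = (V,E) be a finite nonempty simple graph on n vertices and let mac(G) be the minimum average congestion over all dominating sets of G. For every edge set S ⊆ E such that the graph G' = (V, E ∖ S) admits a perfect code, one has (mac(G) − 1)·n ≤ 2·|S|. -/
/-- If deleting the edge set `S` from `G` yields a graph admitting a perfect code,
then `(mac(G) - 1)·n ≤ 2·|S|`. -/
theorem stmt_6 {V : Type*} [Fintype V] [Nonempty V] (G : SimpleGraph V)
    (S : Set (Sym2 V)) (hS : S ⊆ G.edgeSet)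
    (hpc : ∃ D : Set V, PerfectCode (G.deleteEdges S) D) :
    (mac G - 1) * (Fintype.card V : ℝ) ≤ 2 * (S.ncard : ℝ) := by
  classical
  obtain ⟨D, hdom, hone⟩ := hpc
  have hD : Dominating G D := by
    intro v
    obtain ⟨u, hu, hv⟩ := hdom v
    refine ⟨u, hu, ?_⟩
    rcases hv with h | h
    · exact Or.inl h
    · exact Or.inr ((G.deleteEdges_le S) h)
  have hn : (0 : ℝ) < Fintype.card V := by exact_mod_cast Fintype.card_pos
  have hmac : mac G ≤ avgcong G D := by
    apply csInf_le
    · refine ⟨0, ?_⟩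
      rintro x ⟨D', -, rfl⟩
      unfold avgcong
      positivity
    · exact ⟨D, hD, rfl⟩
  let H : SimpleGraph V := SimpleGraph.fromEdgeSet S
  have hpt : ∀ v : V, (closedNbr G v ∩ D).ncard ≤ 1 + H.degree v := by
    intro v
    have hsub : closedNbr G v ∩ D ⊆ (closedNbr (G.deleteEdges S) v ∩ D) ∪ H.neighborSet v := by
      rintro u ⟨hu, huD⟩
      rcases hu with h | h
      · exact Or.inl ⟨Or.inl h, huD⟩
      · have h' : G.Adj v u := h
        by_cases hs : s(v, u) ∈ S
        · right
          exact (SimpleGraph.fromEdgeSet_adj S).2 ⟨hs, h'.ne⟩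
        · left
          exact ⟨Or.inr (SimpleGraph.deleteEdges_adj.2 ⟨h', hs⟩), huD⟩
    have h1 := Set.ncard_le_ncard hsub (Set.toFinite _)
    have h2 := Set.ncard_union_le (closedNbr (G.deleteEdges S) v ∩ D) (H.neighborSet v)
    have h3 : (H.neighborSet v).ncard = H.degree v := by
      rw [Set.ncard_eq_toFinset_card', Set.toFinset_card, SimpleGraph.card_neighborSet_eq_degree]
    rw [hone v, h3] at h2
    exact h1.trans h2
  have hE : H.edgeFinset.card ≤ S.ncard := by
    rw [← Set.ncard_coe_finset, SimpleGraph.coe_edgeFinset]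
    apply Set.ncard_le_ncard _ (Set.toFinite _)
    rw [SimpleGraph.edgeSet_fromEdgeSet]
    exact Set.sdiff_subset
  have hsum : ∑ v : V, (closedNbr G v ∩ D).ncard ≤ Fintype.card V + 2 * S.ncard := by
    calc _ ≤ ∑ v : V, (1 + H.degree v) := Finset.sum_le_sum fun v _ => hpt v
      _ = Fintype.card V + 2 * H.edgeFinset.card := by
        rw [Finset.sum_add_distrib, H.sum_degrees_eq_twice_card_edges]; simp; congr!
      _ ≤ _ := by omega
  have hsum' : (∑ v : V, ((closedNbr G v ∩ D).ncard : ℝ)) ≤ Fintype.card V + 2 * S.ncard := by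
    exact_mod_cast hsum
  have h5 : avgcong G D * Fintype.card V = ∑ v : V, ((closedNbr G v ∩ D).ncard : ℝ) := by
    unfold avgcong
    field_simp
  have h6 := mul_le_mul_of_nonneg_right hmac hn.le
  linarith
end

section
/- Let G = (V,E) be a finite simple graph with minimum degree at least 1, and let D ⊆ V be a minimal dominating set of G (i.e., D is dominating but no proper subset of D is dominating). Then V ∖ D is also a dominating set of G. -/
/-- If `G` has minimum degree at least 1 and `D` is a minimal dominating set,
then the complement of `D` is also a dominating set. -/
theorem stmt_8 {V : Type*} [Fintype V] (G : SimpleGraph V)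
    (hδ : ∀ v : V, (G.neighborSet v).Nonempty)
    (D : Set V) (hD : Dominating G D)
    (hmin : ∀ D' : Set V, D' ⊂ D → ¬ Dominating G D') :
    Dominating G Dᶜ := by
  intro v
  by_contra hv
  have h : ∀ x, v ∈ closedNbr G x → x ∈ D := by
    intro x hx
    by_contra hxD
    exact hv ⟨x, hxD, hx⟩
  have hvD : v ∈ D := h v (Or.inl rfl)
  have hn : ∀ x, G.Adj v x → x ∈ D := fun x hx => h x (Or.inr hx.symm)
  refine hmin (D \ {v}) ⟨Set.diff_subset, fun hs => (hs hvD).2 rfl⟩ ?_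
  intro w
  obtain ⟨u, huD, hu⟩ := hD w
  by_cases huv : u = v
  · subst huv
    rcases hu with hw | hw
    · subst hw
      obtain ⟨x, hx⟩ := hδ w
      have hx' : G.Adj w x := hx
      exact ⟨x, ⟨hn x hx', fun e => hx'.ne e.symm⟩, Or.inr hx'.symm⟩
    · have hw' : G.Adj u w := hw
      exact ⟨w, ⟨hn w hw', fun e => hw'.ne e.symm⟩, Or.inl rfl⟩
  · exact ⟨u, ⟨huD, huv⟩, hu⟩
end

section
/- For every finite nonempty simple graph G = (V,E) with minimum degree at least 1, the minimum average congestion over dominating sets satisfies mac(G) ≤ (d̄ + 1)/2, where d̄ = 2|E|/|V| is the average degree; that is, there exists a dominating set D of G with avgcong(D) ≤ (d̄ + 1)/2. -/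
theorem exists_split {V : Type*} [Fintype V] (G : SimpleGraph V)
    (hδ : ∀ v : V, (G.neighborSet v).Nonempty) :
    ∃ D : Set V, Dominating G D ∧ Dominating G Dᶜ := by
  obtain ⟨D, hD⟩ := (Set.toFinite {S : Set V | ∀ a ∈ S, ∀ b ∈ S, ¬ G.Adj a b}).exists_maximal
    ⟨∅, by simp⟩
  have hI : ∀ a ∈ D, ∀ b ∈ D, ¬ G.Adj a b := hD.prop
  refine ⟨D, fun v => ?_, fun v => ?_⟩
  · by_contra hcon
    push Not at hcon
    have hv : ∀ u ∈ D, ¬ G.Adj u v := fun u hu h => hcon u hu (Or.inr h)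
    have hvD : v ∉ D := fun h => hcon v h (Or.inl rfl)
    apply hvD
    refine hD.le_of_ge (y := insert v D) ?_ (Set.subset_insert v D) (Set.mem_insert v D)
    rintro a (rfl | ha) b (rfl | hb)
    · exact G.irrefl
    · exact fun h => hv b hb h.symm
    · exact hv a ha
    · exact hI a ha b hb
  · by_cases hv : v ∈ D
    · obtain ⟨w, hw⟩ := hδ v
      exact ⟨w, fun h => hI v hv w h hw, Or.inr (SimpleGraph.Adj.symm hw)⟩
    · exact ⟨v, hv, Or.inl rfl⟩

theorem cong_sum {V : Type*} [Fintype V] (G : SimpleGraph V) (D : Set V) :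
    (∑ v : V, ((closedNbr G v ∩ D).ncard : ℝ)) + ∑ v : V, ((closedNbr G v ∩ Dᶜ).ncard : ℝ)
      = 2 * (G.edgeSet.ncard : ℝ) + Fintype.card V := by
  classical
  have h1 : ∀ v : V, (closedNbr G v ∩ D).ncard + (closedNbr G v ∩ Dᶜ).ncard = G.degree v + 1 := by
    intro v
    rw [← Set.sdiff_eq, Set.ncard_inter_add_ncard_sdiff_eq_ncard _ _ (Set.toFinite _), closedNbr,
      Set.ncard_insert_of_notMem (by simp) (Set.toFinite _), Set.ncard_eq_toFinset_card',
      ← SimpleGraph.card_neighborSet_eq_degree, Set.toFinset_card]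
  have h2 := G.sum_degrees_eq_twice_card_edges
  have h3 : G.edgeSet.ncard = G.edgeFinset.card := by
    rw [Set.ncard_eq_toFinset_card']; rfl
  rw [← Finset.sum_add_distrib, h3]
  have h4 : ∑ v : V, ((closedNbr G v ∩ D).ncard + (closedNbr G v ∩ Dᶜ).ncard)
      = 2 * G.edgeFinset.card + Fintype.card V := by
    simp only [h1, Finset.sum_add_distrib, h2]
    simp
  exact_mod_cast h4

/-- For a nonempty graph with minimum degree at least 1,
`mac(G) ≤ (d̄ + 1)/2` where `d̄ = 2|E|/|V|`; i.e. there is a dominating set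
whose average congestion is at most `(d̄ + 1)/2`. -/
theorem stmt_9 {V : Type*} [Fintype V] [Nonempty V] (G : SimpleGraph V)
    (hδ : ∀ v : V, (G.neighborSet v).Nonempty) :
    mac G ≤ (2 * (G.edgeSet.ncard : ℝ) / (Fintype.card V : ℝ) + 1) / 2 ∧
    ∃ D : Set V, Dominating G D ∧
      avgcong G D ≤ (2 * (G.edgeSet.ncard : ℝ) / (Fintype.card V : ℝ) + 1) / 2 := by
  have hex : ∃ D : Set V, Dominating G D ∧
      avgcong G D ≤ (2 * (G.edgeSet.ncard : ℝ) / (Fintype.card V : ℝ) + 1) / 2 := by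
    obtain ⟨D, h1, h2⟩ := exists_split G hδ
    have hs : avgcong G D + avgcong G Dᶜ
        = 2 * (G.edgeSet.ncard : ℝ) / (Fintype.card V : ℝ) + 1 := by
      have hn : (Fintype.card V : ℝ) ≠ 0 := by simp
      rw [avgcong, avgcong, ← add_div, cong_sum, add_div, div_self hn]
    rcases le_total (avgcong G D) (avgcong G Dᶜ) with h | h
    · exact ⟨D, h1, by linarith⟩
    · exact ⟨Dᶜ, h2, by linarith⟩
  refine ⟨?_, hex⟩
  obtain ⟨D, h1, h2⟩ := hex
  refine le_trans (csInf_le ⟨0, ?_⟩ ⟨D, h1, rfl⟩) h2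
  rintro x ⟨S, -, rfl⟩
  unfold avgcong
  positivity
end

section
/- For every k ≥ 1, let G_k be the graph obtained from the complete bipartite graph K_{k,k} with parts A and B by attaching one pendant leaf x_v to each vertex v ∈ A ∪ B. Then D = A ∪ B is a dominating set of G_k of minimum cardinality 2k, and its average congestion is avgcong(D) = k/2 + 1 = n/8 + 1 where n = 4k is the number of vertices of G_k. -/
/-- Vertices of `G_k`: the biclique vertices `Sum.inl (A ⊕ B)` and one pendant leaf
`Sum.inr v` for each biclique vertex `v`. -/
abbrev GkV (k : ℕ) : Type := (Fin k ⊕ Fin k) ⊕ (Fin k ⊕ Fin k)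

/-- The graph `G_k`: a complete bipartite graph `K_{k,k}` with parts `A` (inl) and
`B` (inr), plus one pendant leaf attached to each vertex. -/
def Gk (k : ℕ) : SimpleGraph (GkV k) :=
  SimpleGraph.fromRel (fun x y =>
    (∃ i j : Fin k, x = Sum.inl (Sum.inl i) ∧ y = Sum.inl (Sum.inr j)) ∨
    (∃ v : Fin k ⊕ Fin k, x = Sum.inl v ∧ y = Sum.inr v))

theorem nb_leaf (k : ℕ) (v : Fin k ⊕ Fin k) :
    closedNbr (Gk k) (Sum.inr v) ∩ Set.range (Sum.inl : (Fin k ⊕ Fin k) → GkV k)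
      = {Sum.inl v} := by
  ext x
  rcases x with x | x <;> simp [closedNbr, Gk, SimpleGraph.fromRel_adj]
  rcases x with x | x <;> rcases v with v | v <;> simp [eq_comm]

theorem nb_A (k : ℕ) (i : Fin k) :
    closedNbr (Gk k) (Sum.inl (Sum.inl i)) ∩ Set.range (Sum.inl : (Fin k ⊕ Fin k) → GkV k)
      = insert (Sum.inl (Sum.inl i)) (Set.range (fun j : Fin k => (Sum.inl (Sum.inr j) : GkV k))) := by
  ext x
  rcases x with (x | x) | x <;> simp [closedNbr, Gk, SimpleGraph.fromRel_adj]

theorem nb_B (k : ℕ) (i : Fin k) :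
    closedNbr (Gk k) (Sum.inl (Sum.inr i)) ∩ Set.range (Sum.inl : (Fin k ⊕ Fin k) → GkV k)
      = insert (Sum.inl (Sum.inr i)) (Set.range (fun j : Fin k => (Sum.inl (Sum.inl j) : GkV k))) := by
  ext x
  rcases x with (x | x) | x <;> simp [closedNbr, Gk, SimpleGraph.fromRel_adj]

theorem ncard_range_inj {α β : Type*} [Fintype α] (f : α → β) (hf : Function.Injective f) :
    (Set.range f).ncard = Fintype.card α := by
  rw [← Set.image_univ, Set.ncard_image_of_injective _ hf, Set.ncard_univ, Nat.card_eq_fintype_card]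

theorem card_A (k : ℕ) (i : Fin k) :
    (closedNbr (Gk k) (Sum.inl (Sum.inl i)) ∩
      Set.range (Sum.inl : (Fin k ⊕ Fin k) → GkV k)).ncard = k + 1 := by
  rw [nb_A, Set.ncard_insert_of_notMem (by simp) (Set.toFinite _), ncard_range_inj]
  · simp
  · intro a b h; simpa using h

theorem card_B (k : ℕ) (i : Fin k) :
    (closedNbr (Gk k) (Sum.inl (Sum.inr i)) ∩
      Set.range (Sum.inl : (Fin k ⊕ Fin k) → GkV k)).ncard = k + 1 := by
  rw [nb_B, Set.ncard_insert_of_notMem (by simp) (Set.toFinite _), ncard_range_inj]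
  · simp
  · intro a b h; simpa using h

theorem avg_eq (k : ℕ) (hk : 1 ≤ k) :
    avgcong (Gk k) (Set.range (Sum.inl : (Fin k ⊕ Fin k) → GkV k)) = (k : ℝ) / 2 + 1 := by
  have hk' : (k : ℝ) ≠ 0 := by positivity
  unfold avgcong
  simp only [Fintype.sum_sum_type, card_A, card_B, nb_leaf, Set.ncard_singleton]
  simp
  field_simp
  ring

theorem dom_lower (k : ℕ) (D : Set (GkV k)) (hD : Dominating (Gk k) D) : 2 * k ≤ D.ncard := by
  have h : (Sum.elim id id : GkV k → Fin k ⊕ Fin k) '' D = Set.univ := by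
    ext v
    simp only [Set.mem_univ, iff_true]
    obtain ⟨u, hu, h⟩ := hD (Sum.inr v)
    refine ⟨u, hu, ?_⟩
    rcases u with u | u <;> simp [closedNbr, Gk, SimpleGraph.fromRel_adj] at h
    · rcases h with ⟨a, rfl, rfl⟩ | ⟨a, rfl, rfl⟩ <;> rfl
    · simp [h]
  have h2 := Set.ncard_image_le (f := (Sum.elim id id : GkV k → Fin k ⊕ Fin k)) (Set.toFinite D)
  rw [h, Set.ncard_univ, Nat.card_eq_fintype_card] at h2
  simp at h2
  omega

/-- For `k ≥ 1`, the biclique vertices `A ∪ B` form a dominating set of `G_k` of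
minimum cardinality `2k`, and its average congestion is `k/2 + 1 = n/8 + 1`
where `n = 4k` is the number of vertices. -/
theorem stmt_11 (k : ℕ) (hk : 1 ≤ k) :
    Dominating (Gk k) (Set.range (Sum.inl : (Fin k ⊕ Fin k) → GkV k)) ∧
    (Set.range (Sum.inl : (Fin k ⊕ Fin k) → GkV k)).ncard = 2 * k ∧
    (∀ D' : Set (GkV k), Dominating (Gk k) D' → 2 * k ≤ D'.ncard) ∧
    Fintype.card (GkV k) = 4 * k ∧
    avgcong (Gk k) (Set.range (Sum.inl : (Fin k ⊕ Fin k) → GkV k)) = (k : ℝ) / 2 + 1 ∧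
    avgcong (Gk k) (Set.range (Sum.inl : (Fin k ⊕ Fin k) → GkV k))
      = (Fintype.card (GkV k) : ℝ) / 8 + 1 := by
  refine ⟨?_, ?_, dom_lower k, ?_, avg_eq k hk, ?_⟩
  · intro v
    rcases v with v | v
    · exact ⟨Sum.inl v, ⟨v, rfl⟩, Or.inl rfl⟩
    · refine ⟨Sum.inl v, ⟨v, rfl⟩, Or.inr ?_⟩
      rcases v with v | v <;> simp [Gk, SimpleGraph.fromRel_adj]
  · rw [ncard_range_inj _ Sum.inl_injective]
    simp
    omega
  · simp
    omega
  · rw [avg_eq k hk]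
    simp
    ring
end

section
/- For every real number c there exists a finite simple graph G with mac(G) = 1 and a dominating set D of G of minimum cardinality among all dominating sets of G such that avgcong(D) ≥ c. (Hence minimum-cardinality dominating sets can have average congestion arbitrarily far from the optimum.) -/
def coronaG {n k : ℕ} (e : Fin n ≃ Fin k × Bool) : SimpleGraph (Fin n) where
  Adj u v := u ≠ v ∧ ((e u).1 = (e v).1 ∨ ((e u).2 = true ∧ (e v).2 = true))
  symm := ⟨by
    rintro u v ⟨h, h'⟩
    refine ⟨h.symm, ?_⟩
    rcases h' with h' | h'
    · exact Or.inl h'.symm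
    · exact Or.inr ⟨h'.2, h'.1⟩⟩
  loopless := ⟨fun u h => h.1 rfl⟩

lemma mem_coronaG {n k : ℕ} (e : Fin n ≃ Fin k × Bool) (u v : Fin n) :
    u ∈ closedNbr (coronaG e) v ↔
      ((e v).1 = (e u).1 ∨ ((e v).2 = true ∧ (e u).2 = true)) := by
  simp only [closedNbr, Set.mem_insert_iff, SimpleGraph.mem_neighborSet, coronaG]
  constructor
  · rintro (rfl | h)
    · exact Or.inl rfl
    · exact h.2
  · intro h
    by_cases huv : u = v
    · exact Or.inl huv
    · exact Or.inr ⟨fun h' => huv h'.symm, h⟩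

/-- For every real `c` there is a finite graph `G` with `mac(G) = 1` together with a
minimum-cardinality dominating set `D` whose average congestion is at least `c`. -/
theorem stmt_12 (c : ℝ) :
    ∃ (n : ℕ) (G : SimpleGraph (Fin n)) (D : Set (Fin n)),
      mac G = 1 ∧ Dominating G D ∧
      (∀ D' : Set (Fin n), Dominating G D' → D.ncard ≤ D'.ncard) ∧
      c ≤ avgcong G D := by
  obtain ⟨m, hm⟩ := exists_nat_ge (2 * c)
  obtain ⟨k, hk⟩ : ∃ k, k = m + 1 := ⟨_, rfl⟩
  have hk0 : (0 : ℝ) < k := by subst hk; positivity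
  have hkc : 2 * c ≤ k := by subst hk; push_cast; linarith
  have e : Fin (k * 2) ≃ Fin k × Bool :=
    finProdFinEquiv.symm.trans (Equiv.prodCongr (Equiv.refl _) finTwoEquiv)
  have hDim : {v | (e v).2 = true} = (fun i : Fin k => e.symm (i, true)) '' Set.univ := by
    ext v
    simp only [Set.mem_ofPred_eq, Set.image_univ, Set.mem_range]
    constructor
    · intro h
      exact ⟨(e v).1, by rw [Equiv.symm_apply_eq]; exact Prod.ext rfl h.symm⟩
    · rintro ⟨i, rfl⟩; simp
  have hDcard : ({v | (e v).2 = true}).ncard = k := by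
    rw [hDim, Set.ncard_image_of_injective _ (by intro i j h; simpa using h)]
    simp [Set.ncard_univ]
  refine ⟨k * 2, coronaG e, {v | (e v).2 = true}, ?_, ?_, ?_, ?_⟩
  · apply IsLeast.csInf_eq
    constructor
    · refine ⟨{v | (e v).2 = false}, ?_, ?_⟩
      · intro v
        refine ⟨e.symm ((e v).1, false), by simp, ?_⟩
        rw [mem_coronaG]; simp
      · have h1 : ∀ v, (closedNbr (coronaG e) v ∩ {v | (e v).2 = false}).ncard = 1 := by
          intro v
          rw [Set.ncard_eq_one]
          refine ⟨e.symm ((e v).1, false), ?_⟩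
          ext u
          simp only [Set.mem_inter_iff, mem_coronaG, Set.mem_ofPred_eq, Set.mem_singleton_iff,
            Equiv.eq_symm_apply, Prod.ext_iff]
          constructor
          · rintro ⟨h | h, h'⟩
            · exact ⟨h.symm, h'⟩
            · rw [h.2] at h'; cases h'
          · rintro ⟨h, h'⟩
            exact ⟨Or.inl h.symm, h'⟩
        simp only [avgcong, h1]
        rw [Finset.sum_const, Finset.card_univ, Fintype.card_fin, Nat.cast_one, nsmul_eq_mul, mul_one]
        exact div_self (by push_cast; positivity)
    · rintro x ⟨D, hD, rfl⟩
      rw [avgcong, le_div_iff₀ (by simp; exact_mod_cast hk0)]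
      have : ∑ v : Fin (k * 2), (1 : ℝ) ≤
          ∑ v, ((closedNbr (coronaG e) v ∩ D).ncard : ℝ) := by
        apply Finset.sum_le_sum
        intro v _
        obtain ⟨u, hu, huv⟩ := hD v
        have : 0 < (closedNbr (coronaG e) v ∩ D).ncard := by
          rw [Set.ncard_pos]
          refine ⟨u, ?_, hu⟩
          rw [mem_coronaG] at huv ⊢
          rcases huv with h | h
          · exact Or.inl h.symm
          · exact Or.inr ⟨h.2, h.1⟩
        exact_mod_cast this
      simpa using this
  · intro v
    refine ⟨e.symm ((e v).1, true), by simp, ?_⟩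
    rw [mem_coronaG]; simp
  · intro D' hD'
    rw [hDcard]
    have : (fun v => (e v).1) '' D' = Set.univ := by
      rw [Set.eq_univ_iff_forall]
      intro i
      obtain ⟨u, hu, h⟩ := hD' (e.symm (i, false))
      rw [mem_coronaG] at h
      refine ⟨u, hu, ?_⟩
      simpa using h
    have h2 := Set.ncard_image_le (f := fun v => (e v).1) (s := D') (Set.toFinite _)
    rw [this, Set.ncard_univ] at h2
    simpa using h2
  · rw [avgcong, le_div_iff₀ (by simp; exact_mod_cast hk0), ← Equiv.sum_comp e.symm,
      Fintype.sum_prod_type]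
    have : ∑ i : Fin k, (k : ℝ) ≤ ∑ i : Fin k, ∑ b : Bool,
        ((closedNbr (coronaG e) (e.symm (i, b)) ∩ {v | (e v).2 = true}).ncard : ℝ) := by
      apply Finset.sum_le_sum
      intro i _
      rw [Fintype.sum_bool]
      have : closedNbr (coronaG e) (e.symm (i, true)) ∩ {v | (e v).2 = true}
          = {v | (e v).2 = true} := by
        apply Set.inter_eq_right.2
        intro u hu
        rw [mem_coronaG]
        exact Or.inr ⟨by simp, hu⟩
      rw [this, hDcard]
      simp
    refine le_trans ?_ this
    simp
    nlinarith
end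

section
/- Let G = (V,E) be a finite simple graph, D ⊆ V, and ρ a real number with 0 < ρ < 1 such that |N[v] ∩ N[D]| ≥ ρ·|N[v]| for every vertex v ∈ V. Then every vertex w ∈ W := V ∖ N[D] has at least ρ/(1−ρ) neighbors in U := N[D] ∖ D; that is, |N(w) ∩ U| ≥ ρ/(1−ρ). -/
/-- `N[D] = ⋃_{u ∈ D} N[u]`. -/
def closedNbrSet {V : Type*} (G : SimpleGraph V) (D : Set V) : Set V :=
  ⋃ u ∈ D, closedNbr G u

/-- If every closed neighborhood is at least a `ρ`-fraction dominated by `D`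
(`0 < ρ < 1`), then every undominated vertex `w ∈ W = V ∖ N[D]` has at least
`ρ/(1-ρ)` neighbors in `U = N[D] ∖ D`. -/
theorem stmt_13 {V : Type*} [Fintype V] (G : SimpleGraph V) (D : Set V) (ρ : ℝ)
    (hρ0 : 0 < ρ) (hρ1 : ρ < 1)
    (h : ∀ v : V, ρ * ((closedNbr G v).ncard : ℝ)
      ≤ ((closedNbr G v ∩ closedNbrSet G D).ncard : ℝ))
    (w : V) (hw : w ∈ Set.univ \ closedNbrSet G D) :
    ρ / (1 - ρ) ≤ ((G.neighborSet w ∩ (closedNbrSet G D \ D)).ncard : ℝ) := by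
  have hwn : w ∉ closedNbrSet G D := hw.2
  have e : closedNbr G w ∩ closedNbrSet G D = G.neighborSet w ∩ (closedNbrSet G D \ D) := by
    ext x
    constructor
    · rintro ⟨h1, h2⟩
      rcases h1 with h1 | h1
      · exact absurd (h1 ▸ h2) hwn
      · refine ⟨h1, h2, fun hx => hwn ?_⟩
        exact Set.mem_biUnion hx (Or.inr (SimpleGraph.Adj.symm h1))
    · rintro ⟨h1, h2, _⟩
      exact ⟨Or.inr h1, h2⟩
  have h1 := h w
  rw [e] at h1
  have h2 : (G.neighborSet w ∩ (closedNbrSet G D \ D)).ncard + 1 ≤ (closedNbr G w).ncard := by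
    rw [← e]
    apply Nat.succ_le_of_lt
    apply Set.ncard_lt_ncard _ (Set.toFinite _)
    refine ⟨Set.inter_subset_left, fun hs => hwn (hs (Or.inl rfl)).2⟩
  have h3 : ((G.neighborSet w ∩ (closedNbrSet G D \ D)).ncard : ℝ) + 1
      ≤ ((closedNbr G w).ncard : ℝ) := by exact_mod_cast h2
  rw [div_le_iff₀ (by linarith)]
  nlinarith [mul_le_mul_of_nonneg_left h3 hρ0.le]
end

section
/- Let G = (V,E) be a finite simple graph with maximum degree Δ, D ⊆ V, and ρ a real number with 0 < ρ < 1 such that |N[v] ∩ N[D]| ≥ ρ·|N[v]| for every vertex v ∈ V. Then, with U := N[D] ∖ D and W := V ∖ N[D], one has ρ·|W| ≤ (Δ+1)(1−ρ)²·|U|. -/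
/-- If every closed neighborhood is at least a `ρ`-fraction dominated by `D`
(`0 < ρ < 1`) and `Δ` is the maximum degree, then with `U = N[D] ∖ D` and
`W = V ∖ N[D]` one has `ρ·|W| ≤ (Δ+1)(1-ρ)²·|U|`. -/
theorem stmt_15 {V : Type*} [Fintype V] (G : SimpleGraph V) (D : Set V)
    (Δ : ℕ) (hΔ : ∀ v : V, (G.neighborSet v).ncard ≤ Δ)
    (ρ : ℝ) (hρ0 : 0 < ρ) (hρ1 : ρ < 1)
    (h : ∀ v : V, ρ * ((closedNbr G v).ncard : ℝ)
      ≤ ((closedNbr G v ∩ closedNbrSet G D).ncard : ℝ)) :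
    ρ * (((Set.univ \ closedNbrSet G D : Set V)).ncard : ℝ)
      ≤ ((Δ : ℝ) + 1) * (1 - ρ) ^ 2 * (((closedNbrSet G D \ D : Set V)).ncard : ℝ) := by
  classical
  set N := closedNbrSet G D with hN
  have split : ∀ v, ((closedNbr G v ∩ N).ncard : ℝ) + ((closedNbr G v \ N).ncard : ℝ)
      = ((closedNbr G v).ncard : ℝ) := by
    intro v
    exact_mod_cast Set.ncard_inter_add_ncard_diff_eq_ncard (closedNbr G v) N (Set.toFinite _)
  have hdeg : ∀ v, ((closedNbr G v).ncard : ℝ) ≤ (Δ : ℝ) + 1 := by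
    intro v
    have h1 := Set.ncard_insert_le v (G.neighborSet v)
    have h2 := hΔ v
    have h3 : (closedNbr G v).ncard ≤ Δ + 1 := by
      unfold closedNbr
      omega
    exact_mod_cast h3
  let S : Finset V := (N \ D).toFinset
  let T : Finset V := (Set.univ \ N).toFinset
  have hS : (N \ D).ncard = S.card := Set.ncard_eq_toFinset_card' _
  have hT : (Set.univ \ N).ncard = T.card := Set.ncard_eq_toFinset_card' _
  have hdc := Finset.sum_card_bipartiteAbove_eq_sum_card_bipartiteBelow (s := T) (t := S) G.Adj
  have hW : ∀ w ∈ T, ρ ≤ (1 - ρ) * ((S.bipartiteAbove G.Adj w).card : ℝ) := by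
    intro w hw
    have hwN : w ∉ N := by simpa [T] using hw
    have e : ((closedNbr G w ∩ N).ncard) ≤ (S.bipartiteAbove G.Adj w).card := by
      rw [← Set.ncard_coe_finset]
      apply Set.ncard_le_ncard _ (Set.toFinite _)
      rintro x ⟨hx, hxN⟩
      rcases hx with rfl | hx
      · exact absurd hxN hwN
      · have hx' : G.Adj w x := hx
        have hxD : x ∉ D := by
          intro hxD
          apply hwN
          rw [hN]
          unfold closedNbrSet
          exact Set.mem_biUnion hxD (Or.inr hx'.symm)
        simp [Finset.bipartiteAbove, S, hxN, hxD, hx']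
    have b1 : 1 ≤ (closedNbr G w \ N).ncard := by
      rw [Nat.one_le_iff_ne_zero]
      exact Set.ncard_ne_zero_of_mem (a := w) ⟨Or.inl rfl, hwN⟩ (Set.toFinite _)
    have e' : ((closedNbr G w ∩ N).ncard : ℝ) ≤ (S.bipartiteAbove G.Adj w).card := by
      exact_mod_cast e
    have b1' : (1 : ℝ) ≤ (closedNbr G w \ N).ncard := by exact_mod_cast b1
    have := h w
    have := split w
    nlinarith
  have hU : ∀ u ∈ S, ((T.bipartiteBelow G.Adj u).card : ℝ) ≤ (1 - ρ) * ((Δ : ℝ) + 1) := by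
    intro u hu
    have e : (T.bipartiteBelow G.Adj u).card ≤ (closedNbr G u \ N).ncard := by
      rw [← Set.ncard_coe_finset]
      apply Set.ncard_le_ncard _ (Set.toFinite _)
      intro x hx
      have hx' : x ∉ N ∧ G.Adj x u := by simpa [Finset.bipartiteBelow, T] using hx
      exact ⟨Or.inr hx'.2.symm, hx'.1⟩
    have e' : ((T.bipartiteBelow G.Adj u).card : ℝ) ≤ (closedNbr G u \ N).ncard := by
      exact_mod_cast e
    have := h u
    have := split u
    have := hdeg u
    nlinarith
  have s1 := Finset.sum_le_sum hW
  have s2 := Finset.sum_le_sum hU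
  rw [← Finset.mul_sum] at s1
  simp only [Finset.sum_const, nsmul_eq_mul] at s1 s2
  have hdc' : (∑ w ∈ T, ((S.bipartiteAbove G.Adj w).card : ℝ))
      = ∑ u ∈ S, ((T.bipartiteBelow G.Adj u).card : ℝ) := by exact_mod_cast hdc
  rw [hdc'] at s1
  rw [hS, hT]
  have := mul_le_mul_of_nonneg_left s2 (by linarith : (0 : ℝ) ≤ 1 - ρ)
  linarith
end
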